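/- Let α, β ∈ (0,1) with α + β < 1, and let f be a Schwartz function on ℝ with f(n^α) = f(-n^α) = 0 and f̂(n^β) = f̂(-n^β) = 0 for every natural number n ≥ 0. Then there exist constants τ > 0 and C > 0, depending on f, α, β, such that I_k(f) ≤ C e^{τ k log k + C k} for every natural number k ≥ 1, where I_k(f) = ∫_ℝ |f(y)| |y|^k dy. -/

import Mathlib

open MeasureTheory

/-- The Fourier transform `f̂(ξ) = ∫_ℝ f(x) e^{2πi x ξ} dx`. -/
noncomputable def fourierTransform (f : ℝ → ℂ) (ξ : ℝ) : ℂ :=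
  ∫ x : ℝ, f x * Complex.exp (2 * Real.pi * Complex.I * x * ξ)

/-- The weighted integral `I_k(g) = ∫_ℝ |g(y)| |y|^k dy`. -/
noncomputable def weightedIntegral (g : ℝ → ℂ) (k : ℕ) : ℝ :=
  ∫ y : ℝ, ‖g y‖ * |y| ^ k

open scoped ContDiff FourierTransform

/-- Iterated Rolle theorem. -/
theorem exists_iteratedDeriv_eq_zero (n : ℕ) (g : ℝ → ℝ) (hg : ContDiff ℝ ∞ g) (x : ℕ → ℝ)
    (hx : ∀ i < n, x i < x (i + 1)) (h0 : ∀ i ≤ n, g (x i) = 0) :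
    ∃ c, iteratedDeriv n g c = 0 := by
  induction n generalizing g x with
  | zero => exact ⟨x 0, by simpa using h0 0 le_rfl⟩
  | succ n ih =>
    have key : ∀ i, ∃ c, i ≤ n → x i < c ∧ c < x (i + 1) ∧ deriv g c = 0 := by
      intro i
      by_cases hi : i ≤ n
      · obtain ⟨c, hc, h⟩ := exists_deriv_eq_zero (hx i (by omega)) hg.continuous.continuousOn
          ((h0 i (by omega)).trans (h0 (i + 1) (by omega)).symm)
        exact ⟨c, fun _ => ⟨hc.1, hc.2, h⟩⟩
      · exact ⟨0, fun h => absurd h hi⟩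
    choose c hc using key
    rw [iteratedDeriv_succ']
    refine ih (deriv g) (hg.iterate_deriv 1) c (fun i hi => ?_) fun i hi => (hc i hi).2.2
    exact (hc i hi.le).2.1.trans (hc (i + 1) hi).1

theorem iteratedDeriv_polynomial_eval (P : Polynomial ℝ) (n : ℕ) :
    iteratedDeriv n (fun x => P.eval x) =
      fun x => (Polynomial.derivative^[n] P).eval x := by
  induction n generalizing P with
  | zero => simp
  | succ n ih =>
    rw [iteratedDeriv_succ', Function.iterate_succ_apply, ← ih]
    congr 1
    ext x
    simp

theorem Polynomial.Monic.iterate_derivative_natDegree {P : Polynomial ℝ} (hP : P.Monic) :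
    Polynomial.derivative^[P.natDegree] P = Polynomial.C (P.natDegree.factorial : ℝ) := by
  have h := Polynomial.natDegree_iterate_derivative P P.natDegree
  rw [Nat.sub_self, Nat.le_zero] at h
  rw [Polynomial.eq_C_of_natDegree_eq_zero h, Polynomial.coeff_iterate_derivative]
  simp [hP.coeff_natDegree, Nat.descFactorial_self]

/-- Interpolation error bound at a point lying to the left of all the nodes. -/
theorem abs_le_of_zeros_right (m : ℕ) (g : ℝ → ℝ) (hg : ContDiff ℝ ∞ g) (y δ M : ℝ) (x : ℕ → ℝ)
    (hyx : y < x 0) (hx : StrictMono x) (h0 : ∀ i, g (x i) = 0)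
    (hδ : ∀ i : ℕ, x i - y ≤ δ * (i + 1)) (hM : ∀ t, |iteratedDeriv m g t| ≤ M) :
    |g y| ≤ δ ^ m * M := by
  set P : Polynomial ℝ := ∏ i ∈ Finset.range m, (Polynomial.X - Polynomial.C (x i)) with hP
  have hPm : P.Monic := Polynomial.monic_prod_of_monic _ _ fun i _ => Polynomial.monic_X_sub_C _
  have hPd : P.natDegree = m := by
    rw [hP, Polynomial.natDegree_prod_of_monic _ _ fun i _ => Polynomial.monic_X_sub_C _]
    simp
  have hev : ∀ t, P.eval t = ∏ i ∈ Finset.range m, (t - x i) := by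
    intro t
    simp [hP, Polynomial.eval_prod]
  have hlt : ∀ i, y < x i := fun i => hyx.trans_le (hx.monotone (Nat.zero_le i))
  have hPy : P.eval y ≠ 0 := by
    rw [hev, Finset.prod_ne_zero_iff]
    exact fun i _ => (sub_neg.2 (hlt i)).ne
  have hPle : |P.eval y| ≤ δ ^ m * m.factorial := by
    rw [hev, Finset.abs_prod]
    calc ∏ i ∈ Finset.range m, |y - x i| ≤ ∏ i ∈ Finset.range m, (δ * ((i : ℝ) + 1)) := by
          refine Finset.prod_le_prod (fun i _ => abs_nonneg _) fun i _ => ?_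
          rw [abs_sub_comm, abs_of_pos (sub_pos.2 (hlt i))]
          exact hδ i
      _ = δ ^ m * m.factorial := by
          rw [Finset.prod_mul_distrib, ← Finset.prod_range_add_one_eq_factorial]
          push_cast
          simp
  set c := g y / P.eval y with hc
  have hgy : g y = c * P.eval y := (div_mul_cancel₀ _ hPy).symm
  have hPc : ContDiff ℝ ∞ fun t => c * P.eval t := contDiff_const.mul (Polynomial.contDiff_aeval P ∞)
  obtain ⟨ξ, hξ⟩ := exists_iteratedDeriv_eq_zero m (fun t => g t - c * P.eval t) (hg.sub hPc)
    (fun i => Nat.casesOn i y x)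
    (fun i _ => by
      cases i with
      | zero => exact hyx
      | succ i => exact hx (Nat.lt_succ_self i))
    (fun i hi => by
      cases i with
      | zero => simp [← hgy]
      | succ i =>
        have : P.eval (x i) = 0 := by
          rw [hev]
          exact Finset.prod_eq_zero (Finset.mem_range.2 hi) (sub_self _)
        simp [h0, this])
  have hD : iteratedDeriv m g ξ = c * m.factorial := by
    have h1 : iteratedDeriv m (fun t => g t - c * P.eval t) ξ =
        iteratedDeriv m g ξ - iteratedDeriv m (fun t => c * P.eval t) ξ :=
      iteratedDeriv_sub (hg.contDiffAt.of_le (mod_cast le_top)) (hPc.contDiffAt.of_le (mod_cast le_top))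
    have h2 : iteratedDeriv m (fun t => c * P.eval t) ξ = c * m.factorial := by
      have h3 : (fun t => c * P.eval t) = fun t => (Polynomial.C c * P).eval t := by
        ext t
        simp
      rw [h3, iteratedDeriv_polynomial_eval, Polynomial.iterate_derivative_C_mul]
      have := hPm.iterate_derivative_natDegree
      rw [hPd] at this
      simp [this]
    rw [h1, h2] at hξ
    linarith
  have hδ0 : 0 ≤ δ := by
    have := hδ 0
    have := hlt 0
    norm_num at *
    linarith
  calc |g y| = |c| * |P.eval y| := by rw [hgy, abs_mul]
    _ ≤ |c| * (δ ^ m * m.factorial) := by gcongr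
    _ = δ ^ m * |iteratedDeriv m g ξ| := by rw [hD, abs_mul, Nat.abs_cast]; ring
    _ ≤ δ ^ m * M := by gcongr; exact hM ξ

theorem norm_le_of_zeros_right (m : ℕ) (h : ℝ → ℂ) (hh : ContDiff ℝ ∞ h) (y δ M : ℝ) (x : ℕ → ℝ)
    (hyx : y < x 0) (hx : StrictMono x) (h0 : ∀ i, h (x i) = 0)
    (hδ : ∀ i : ℕ, x i - y ≤ δ * (i + 1)) (hM : ∀ t, ‖iteratedDeriv m h t‖ ≤ M) :
    ‖h y‖ ≤ δ ^ m * M := by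
  obtain ⟨L, hL, hLy⟩ := exists_dual_vector'' ℝ (h y)
  have := abs_le_of_zeros_right m (fun t => L (h t)) (L.contDiff.comp hh) y δ M x hyx hx
    (fun i => by simp [h0]) hδ (fun t => by
      rw [← Real.norm_eq_abs, ← norm_iteratedFDeriv_eq_norm_iteratedDeriv]
      refine (L.norm_iteratedFDeriv_comp_left (f := h) hh.contDiffAt (mod_cast le_top)).trans ?_
      rw [norm_iteratedFDeriv_eq_norm_iteratedDeriv]
      calc ‖L‖ * _ ≤ 1 * M := by
            gcongr
            exact hM t
        _ = M := one_mul M)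
  rw [hLy] at this
  simpa using this

/-- A function vanishing at all powers `n ^ β` is small far away, in terms of its derivatives. -/
theorem norm_le_of_zeros_rpow {β : ℝ} (hβ : β ∈ Set.Ioo (0 : ℝ) 1) (m : ℕ) (h : ℝ → ℂ)
    (hh : ContDiff ℝ ∞ h) (h0 : ∀ n : ℕ, h ((n : ℝ) ^ β) = 0) (M : ℝ)
    (hM : ∀ t, ‖iteratedDeriv m h t‖ ≤ M) (y : ℝ) (hy : 0 < y) :
    ‖h y‖ ≤ (y ^ (-((1 - β) / β))) ^ m * M := by
  obtain ⟨hβ0, hβ1⟩ := hβ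
  set z := y ^ (β⁻¹) with hz
  have hz0 : 0 < z := Real.rpow_pos_of_pos hy _
  have hzy : z ^ β = y := by
    rw [hz, ← Real.rpow_mul hy.le, inv_mul_cancel₀ hβ0.ne', Real.rpow_one]
  set N := ⌊z⌋₊ + 1 with hN
  have hzN : z < N := by simpa [hN] using Nat.lt_floor_add_one z
  have hNz : (N : ℝ) ≤ z + 1 := by
    have := Nat.floor_le hz0.le
    push_cast [hN]
    linarith
  refine norm_le_of_zeros_right m h hh y _ M (fun i => ((N + i : ℕ) : ℝ) ^ β) ?_ ?_
    (fun i => h0 _) (fun i => ?_) hM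
  · rw [← hzy]
    exact Real.rpow_lt_rpow hz0.le (by simpa using hzN) hβ0
  · intro i j hij
    exact Real.rpow_lt_rpow (Nat.cast_nonneg _) (by simpa using hij) hβ0
  · have hpow : y ^ (-((1 - β) / β)) = y / z := by
      have : -((1 - β) / β) = 1 - β⁻¹ := by field_simp; ring
      rw [this, Real.rpow_sub hy, Real.rpow_one]
    have h1 : ((N + i : ℕ) : ℝ) ≤ z * (1 + (i + 1) / z) := by
      have : z * (1 + (i + 1) / z) = z + 1 + i := by field_simp; ring
      rw [this]
      push_cast
      linarith
    have h2 : (1 + ((i : ℝ) + 1) / z) ^ β ≤ 1 + β * ((i + 1) / z) :=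
      rpow_one_add_le_one_add_mul_self (by
        have : (0 : ℝ) ≤ (i + 1) / z := by positivity
        linarith) hβ0.le hβ1.le
    have h3 : ((N + i : ℕ) : ℝ) ^ β ≤ y * (1 + 1 * ((i + 1) / z)) := by
      calc ((N + i : ℕ) : ℝ) ^ β ≤ (z * (1 + (i + 1) / z)) ^ β :=
            Real.rpow_le_rpow (Nat.cast_nonneg _) h1 hβ0.le
        _ = y * (1 + ((i : ℝ) + 1) / z) ^ β := by
            rw [Real.mul_rpow hz0.le (by positivity), hzy]
        _ ≤ y * (1 + β * ((i + 1) / z)) := by gcongr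
        _ ≤ _ := by gcongr
    rw [hpow]
    calc _ ≤ y * (1 + 1 * (((i : ℝ) + 1) / z)) - y := by simpa using h3
      _ = _ := by ring

/-- A recursive inequality that reduces the index by a factor forces exponential growth. -/
theorem exists_exp_bound_of_recursion (u : ℕ → ℝ) (r c : ℝ) (hr : r < 1)
    (hc : 0 ≤ c)
    (hu : ∀ k : ℕ, ∃ m : ℕ, (m : ℝ) ≤ r * k + c ∧ u k ≤ Real.exp (c * (k + 1)) * u m) :
    ∃ M > 0, ∃ L > 0, ∀ k : ℕ, u k ≤ M * Real.exp (L * k) := by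
  set L := (c + c * c + 1) / (1 - r) with hL
  have hr1 : 0 < 1 - r := sub_pos.2 hr
  have hL0 : 0 < L := by positivity
  have hLr : L * (1 - r) = c + c * c + 1 := div_mul_cancel₀ _ hr1.ne'
  set K := c + L * c with hK
  have hK0 : 0 ≤ K := by positivity
  set k₀ := ⌈K⌉₊ + ⌈c / (1 - r)⌉₊ with hk₀
  refine ⟨1 + ∑ i ∈ Finset.range (k₀ + 1), |u i|, by positivity, L, hL0, fun k => ?_⟩
  set M := 1 + ∑ i ∈ Finset.range (k₀ + 1), |u i| with hM
  have hM0 : 0 < M := by positivity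
  induction k using Nat.strong_induction_on with
  | _ k ih =>
  rcases le_or_gt k k₀ with hk | hk
  · have h1 : |u k| ≤ ∑ i ∈ Finset.range (k₀ + 1), |u i| :=
      Finset.single_le_sum (f := fun i => |u i|) (fun i _ => abs_nonneg _)
        (Finset.mem_range.2 (by omega))
    have h2 : u k ≤ M := by linarith [le_abs_self (u k)]
    exact h2.trans (le_mul_of_one_le_right hM0.le (Real.one_le_exp (by positivity)))
  · obtain ⟨m, hm, hum⟩ := hu k
    have hk' : (k₀ : ℝ) < k := by exact_mod_cast hk
    push_cast [hk₀] at hk'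
    have e1 := Nat.le_ceil K
    have e2 := Nat.le_ceil (c / (1 - r))
    have e3 : c / (1 - r) < k := by linarith
    rw [div_lt_iff₀ hr1] at e3
    have hmk : m < k := by
      have : (m : ℝ) < k := by linarith
      exact_mod_cast this
    have e4 : K < k := by
      have : (0 : ℝ) ≤ ⌈c / (1 - r)⌉₊ := Nat.cast_nonneg _
      linarith
    calc u k ≤ Real.exp (c * (k + 1)) * u m := hum
      _ ≤ Real.exp (c * (k + 1)) * (M * Real.exp (L * m)) := by gcongr; exact ih m hmk
      _ = M * Real.exp (c * (k + 1) + L * m) := by rw [Real.exp_add]; ring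
      _ ≤ M * Real.exp (L * k) := by
          gcongr
          have h1 : L * m ≤ L * (r * k + c) := by gcongr
          have h2 : L * k = L * r * k + (c + c * c + 1) * k := by rw [← hLr]; ring
          have h3 : 0 ≤ c * c * k := by positivity
          nlinarith

theorem integrable_norm_mul_abs_pow (F : SchwartzMap ℝ ℂ) (k : ℕ) :
    Integrable fun y : ℝ => ‖F y‖ * |y| ^ k := by
  simpa [mul_comm] using F.integrable_pow_mul volume k

theorem weightedIntegral_nonneg (g : ℝ → ℂ) (k : ℕ) : 0 ≤ weightedIntegral g k :=
  integral_nonneg fun _ => by positivity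

theorem weightedIntegral_comp_neg (g : ℝ → ℂ) (k : ℕ) :
    weightedIntegral (fun y => g (-y)) k = weightedIntegral g k := by
  unfold weightedIntegral
  rw [← integral_neg_eq_self]
  simp

theorem norm_iteratedDeriv_fourier_le (F : SchwartzMap ℝ ℂ) (m : ℕ) (t : ℝ) :
    ‖iteratedDeriv m (𝓕 F : SchwartzMap ℝ ℂ) t‖ ≤ (2 * Real.pi) ^ m * weightedIntegral F m := by
  have hint : ∀ n : ℕ, (n : ℕ∞) ≤ ⊤ → Integrable fun x : ℝ => x ^ n • F x := by
    intro n _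
    refine (integrable_norm_mul_abs_pow F n).mono' (by fun_prop) (.of_forall fun x => ?_)
    simp [mul_comm]
  rw [SchwartzMap.fourier_coe, Real.iteratedDeriv_fourier hint le_top, Real.fourier_real_eq]
  refine (norm_integral_le_integral_norm _).trans (le_of_eq ?_)
  rw [weightedIntegral, ← integral_const_mul]
  congr 1
  ext x
  simp [abs_of_pos Real.pi_pos, mul_pow]
  ring

/-- Decay of the Fourier transform, when it vanishes at the points `± n ^ β`. -/
theorem norm_fourier_le_of_zeros {β : ℝ} (hβ : β ∈ Set.Ioo (0 : ℝ) 1) (F : SchwartzMap ℝ ℂ)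
    (h0 : ∀ n : ℕ, 𝓕 F ((n : ℝ) ^ β) = 0 ∧ 𝓕 F (-(n : ℝ) ^ β) = 0) (m : ℕ) (y : ℝ)
    (hy : y ≠ 0) :
    ‖𝓕 F y‖ ≤ (|y| ^ (-((1 - β) / β))) ^ m * ((2 * Real.pi) ^ m * weightedIntegral F m) := by
  rcases hy.lt_or_gt with hy | hy
  · rw [abs_of_neg hy]
    have := norm_le_of_zeros_rpow hβ m (fun t => 𝓕 F (-t))
      (((𝓕 F).smooth ⊤).comp contDiff_neg) (fun n => (h0 n).2) _
      (fun t => by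
        rw [iteratedDeriv_comp_neg, norm_smul]
        simpa using norm_iteratedDeriv_fourier_le F m (-t)) (-y) (neg_pos.2 hy)
    simpa using this
  · rw [abs_of_pos hy]
    exact norm_le_of_zeros_rpow hβ m _ ((𝓕 F).smooth ⊤) (fun n => (h0 n).1) _
      (norm_iteratedDeriv_fourier_le F m) y hy

theorem weightedIntegral_fourier_le {β : ℝ} (hβ : β ∈ Set.Ioo (0 : ℝ) 1) (F : SchwartzMap ℝ ℂ)
    (h0 : ∀ n : ℕ, 𝓕 F ((n : ℝ) ^ β) = 0 ∧ 𝓕 F (-(n : ℝ) ^ β) = 0) (k m : ℕ)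
    (hkm : (k : ℝ) + 2 ≤ (1 - β) / β * m) :
    weightedIntegral (𝓕 F : SchwartzMap ℝ ℂ) k ≤
      weightedIntegral (𝓕 F : SchwartzMap ℝ ℂ) 0 +
        (2 * Real.pi) ^ (m + 1) * weightedIntegral F m := by
  set A := (2 * Real.pi) ^ m * weightedIntegral F m with hA
  have hA0 : 0 ≤ A := mul_nonneg (by positivity) (weightedIntegral_nonneg _ _)
  have hpt : ∀ y : ℝ, ‖𝓕 F y‖ * |y| ^ k ≤ ‖𝓕 F y‖ * |y| ^ 0 + 2 * A * (1 + y ^ 2)⁻¹ := by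
    intro y
    rcases le_or_gt |y| 1 with hy | hy
    · have : |y| ^ k ≤ 1 := pow_le_one₀ (abs_nonneg y) hy
      have h2 : 0 ≤ 2 * A * (1 + y ^ 2)⁻¹ := by positivity
      rw [pow_zero]
      exact (mul_le_mul_of_nonneg_left this (norm_nonneg _)).trans (le_add_of_nonneg_right h2)
    · have hy0 : 0 < |y| := one_pos.trans hy
      have h1 := norm_fourier_le_of_zeros hβ F h0 m y (abs_pos.1 hy0)
      have h2 : (|y| ^ (-((1 - β) / β))) ^ m * |y| ^ k ≤ 2 * (1 + y ^ 2)⁻¹ := by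
        calc (|y| ^ (-((1 - β) / β))) ^ m * |y| ^ k
            = |y| ^ (-((1 - β) / β) * m + k) := by
              rw [Real.rpow_add hy0, Real.rpow_mul hy0.le, Real.rpow_natCast, Real.rpow_natCast]
          _ ≤ |y| ^ (-2 : ℝ) := Real.rpow_le_rpow_of_exponent_le hy.le (by linarith)
          _ = (y ^ 2)⁻¹ := by
              rw [Real.rpow_neg hy0.le]
              norm_num [sq_abs]
          _ ≤ 2 * (1 + y ^ 2)⁻¹ := by
              have : 1 ≤ y ^ 2 := by rw [← sq_abs]; exact one_le_pow₀ hy.le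
              rw [← div_eq_mul_inv, inv_eq_one_div, div_le_div_iff₀ (by positivity) (by positivity)]
              linarith
      calc ‖𝓕 F y‖ * |y| ^ k ≤ ((|y| ^ (-((1 - β) / β))) ^ m * A) * |y| ^ k := by gcongr
        _ = A * ((|y| ^ (-((1 - β) / β))) ^ m * |y| ^ k) := by ring
        _ ≤ A * (2 * (1 + y ^ 2)⁻¹) := by gcongr
        _ = 2 * A * (1 + y ^ 2)⁻¹ := by ring
        _ ≤ _ := le_add_of_nonneg_left (by positivity)
  have hi0 := integrable_norm_mul_abs_pow (𝓕 F) 0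
  have hi1 : Integrable fun y : ℝ => 2 * A * (1 + y ^ 2)⁻¹ :=
    integrable_inv_one_add_sq.const_mul _
  calc weightedIntegral (𝓕 F : SchwartzMap ℝ ℂ) k
      ≤ ∫ y : ℝ, (‖𝓕 F y‖ * |y| ^ 0 + 2 * A * (1 + y ^ 2)⁻¹) :=
        integral_mono (integrable_norm_mul_abs_pow (𝓕 F) k) (hi0.add hi1) hpt
    _ = _ := by
        rw [integral_add hi0 hi1, integral_const_mul, integral_univ_inv_one_add_sq, hA]
        unfold weightedIntegral
        ring

/-- The moments of the Fourier transform are controlled by moments of the function whose order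
is smaller by the factor `(1 - β) / β`. -/
theorem exists_moment_comparison {β : ℝ} (hβ : β ∈ Set.Ioo (0 : ℝ) 1) (F : SchwartzMap ℝ ℂ)
    (h0 : ∀ n : ℕ, 𝓕 F ((n : ℝ) ^ β) = 0 ∧ 𝓕 F (-(n : ℝ) ^ β) = 0) :
    ∃ c : ℝ, 0 ≤ c ∧ ∀ k : ℕ, ∃ m : ℕ, (m : ℝ) ≤ β / (1 - β) * k + c ∧
      1 + weightedIntegral (𝓕 F : SchwartzMap ℝ ℂ) k ≤
        Real.exp (c * (k + 1)) * (1 + weightedIntegral F m) := by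
  obtain ⟨hβ0, hβ1⟩ := id hβ
  have h1β : 0 < 1 - β := sub_pos.2 hβ1
  set q := β / (1 - β) with hq
  have hq0 : 0 < q := by positivity
  set D := weightedIntegral (𝓕 F : SchwartzMap ℝ ℂ) 0 with hD
  have hD0 : 0 ≤ D := weightedIntegral_nonneg _ _
  have hK : 1 < 2 * Real.pi := by linarith [Real.pi_gt_three]
  set κ := Real.log (2 * Real.pi) with hκ
  have hκ0 : 0 < κ := Real.log_pos hK
  set l := Real.log (1 + D) with hl
  have hl0 : 0 ≤ l := Real.log_nonneg (by linarith)
  refine ⟨(2 * q + 1) + l + κ * (2 * q + 2), by positivity, fun k => ?_⟩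
  set m := ⌈q * (k + 2)⌉₊ with hm
  have hm1 : q * (k + 2) ≤ m := Nat.le_ceil _
  have hm2 : (m : ℝ) < q * (k + 2) + 1 := Nat.ceil_lt_add_one (by positivity)
  have hkm : (k : ℝ) + 2 ≤ (1 - β) / β * m := by
    calc (k : ℝ) + 2 = (1 - β) / β * (q * (k + 2)) := by rw [hq]; field_simp
      _ ≤ _ := by gcongr
  refine ⟨m, ?_, ?_⟩
  · have : 0 ≤ l + κ * (2 * q + 2) := by positivity
    linarith
  · have hB := weightedIntegral_nonneg F m
    have hp : 1 ≤ (2 * Real.pi) ^ (m + 1) := one_le_pow₀ hK.le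
    have hexp : (1 + D) * (2 * Real.pi) ^ (m + 1) = Real.exp (l + κ * (m + 1)) := by
      rw [Real.exp_add, hl, Real.exp_log (by linarith), hκ, ← Nat.cast_add_one,
        ← Real.rpow_def_of_pos (by positivity), Real.rpow_natCast]
    calc 1 + weightedIntegral (𝓕 F : SchwartzMap ℝ ℂ) k
        ≤ (1 + D) + (2 * Real.pi) ^ (m + 1) * weightedIntegral F m := by
          linarith [weightedIntegral_fourier_le hβ F h0 k m hkm]
      _ ≤ (1 + D) * (2 * Real.pi) ^ (m + 1) +
          (1 + D) * (2 * Real.pi) ^ (m + 1) * weightedIntegral F m := by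
          gcongr
          · exact le_mul_of_one_le_right (by linarith) hp
          · exact le_mul_of_one_le_left (by positivity) (by linarith)
      _ = Real.exp (l + κ * (m + 1)) * (1 + weightedIntegral F m) := by rw [← hexp]; ring
      _ ≤ _ := by
          gcongr
          have h1 : κ * (m + 1) ≤ κ * (2 * q + 2) * (k + 1) := by
            rw [mul_assoc]
            gcongr
            have : 0 ≤ q * k := by positivity
            have : (0 : ℝ) ≤ k := Nat.cast_nonneg _
            nlinarith
          have h2 : l ≤ l * (k + 1) := le_mul_of_one_le_right hl0 (by simp)
          have h3 : 0 ≤ (2 * q + 1) * ((k : ℝ) + 1) := by positivity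
          linarith

theorem fourierTransform_eq_fourier_neg (f : SchwartzMap ℝ ℂ) (ξ : ℝ) :
    fourierTransform f ξ = 𝓕 f (-ξ) := by
  rw [SchwartzMap.fourier_coe, Real.fourier_real_eq_integral_exp_smul, fourierTransform]
  congr 1
  ext x
  rw [smul_eq_mul, mul_comm]
  congr 2
  push_cast
  ring

theorem fourier_fourier_eq_comp_neg (f : SchwartzMap ℝ ℂ) (x : ℝ) :
    𝓕 (𝓕 f) x = f (-x) := by
  have h : 𝓕⁻ (𝓕 f) (-x) = f (-x) := by rw [FourierTransform.fourierInv_fourier_eq]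
  rw [← h, SchwartzMap.fourierInv_coe, Real.fourierInv_eq_fourier_neg, neg_neg,
    SchwartzMap.fourier_coe]

theorem weighted_integral_growth_bound (α β : ℝ)
    (hα : α ∈ Set.Ioo (0 : ℝ) 1) (hβ : β ∈ Set.Ioo (0 : ℝ) 1) (hsum : α + β < 1)
    (f : SchwartzMap ℝ ℂ)
    (hf : ∀ n : ℕ, f ((n : ℝ) ^ α) = 0 ∧ f (-(n : ℝ) ^ α) = 0)
    (hfhat : ∀ n : ℕ, fourierTransform f ((n : ℝ) ^ β) = 0 ∧
      fourierTransform f (-(n : ℝ) ^ β) = 0) :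
    ∃ τ > 0, ∃ C > 0, ∀ k : ℕ, 1 ≤ k →
      weightedIntegral f k ≤
        C * Real.exp (τ * (k : ℝ) * Real.log (k : ℝ) + C * (k : ℝ)) := by
  obtain ⟨hα0, hα1⟩ := id hα
  obtain ⟨hβ0, hβ1⟩ := id hβ
  have hα' : 0 < 1 - α := sub_pos.2 hα1
  have hβ' : 0 < 1 - β := sub_pos.2 hβ1
  obtain ⟨c, hc0, hc⟩ := exists_moment_comparison hβ f fun n => by
    have := hfhat n
    rw [fourierTransform_eq_fourier_neg, fourierTransform_eq_fourier_neg, neg_neg] at this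
    exact this.symm
  obtain ⟨d, hd0, hd⟩ := exists_moment_comparison hα (𝓕 f) fun n => by
    rw [fourier_fourier_eq_comp_neg, fourier_fourier_eq_comp_neg, neg_neg]
    exact (hf n).symm
  have hff : ∀ k, weightedIntegral (𝓕 (𝓕 f) : SchwartzMap ℝ ℂ) k = weightedIntegral f k := by
    intro k
    rw [← weightedIntegral_comp_neg f, funext (fourier_fourier_eq_comp_neg f)]
  simp only [hff] at hd
  set p := α / (1 - α) with hp
  set q := β / (1 - β) with hq
  have hp0 : 0 < p := by positivity
  have hq0 : 0 < q := by positivity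
  have hpq : q * p < 1 := by
    rw [hp, hq, div_mul_div_comm, div_lt_one (by positivity)]
    nlinarith
  obtain ⟨M, hM, L, hL, hbound⟩ := exists_exp_bound_of_recursion
    (fun k => 1 + weightedIntegral f k) (q * p) (q * d + c + d + c * (p + d + 1)) hpq
    (by positivity)
    (fun k => by
      obtain ⟨m, hm, hm'⟩ := hd k
      obtain ⟨j, hj, hj'⟩ := hc m
      have hk0 : (0 : ℝ) ≤ k := Nat.cast_nonneg k
      refine ⟨j, ?_, ?_⟩
      · have h1 : q * m ≤ q * (p * k + d) := by gcongr
        have h2 : 0 ≤ d + c * (p + d + 1) := by positivity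
        linarith
      · have hj0 := weightedIntegral_nonneg f j
        calc 1 + weightedIntegral f k
            ≤ Real.exp (d * (k + 1)) * (Real.exp (c * (m + 1)) * (1 + weightedIntegral f j)) :=
              hm'.trans (by gcongr)
          _ = Real.exp (d * (k + 1) + c * (m + 1)) * (1 + weightedIntegral f j) := by
              rw [Real.exp_add]; ring
          _ ≤ _ := by
              gcongr
              have h1 : c * (m + 1) ≤ c * (p + d + 1) * (k + 1) := by
                rw [mul_assoc]
                gcongr
                have : 0 ≤ d * k := by positivity
                nlinarith
              have h2 : 0 ≤ (q * d + c) * ((k : ℝ) + 1) := by positivity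
              linarith)
  refine ⟨1, one_pos, max M L, lt_max_of_lt_left hM, fun k hk => ?_⟩
  have hlog : 0 ≤ Real.log (k : ℝ) := Real.log_nonneg (by exact_mod_cast hk)
  calc weightedIntegral f k ≤ M * Real.exp (L * k) := by linarith [hbound k]
    _ ≤ max M L * Real.exp (1 * k * Real.log k + max M L * k) := by
        have h1 : L * k ≤ max M L * k := by gcongr; exact le_max_right _ _
        have h2 : 0 ≤ 1 * (k : ℝ) * Real.log k := by positivity
        gcongr
        · exact le_max_left _ _
        · linarith
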